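/- For every slot t ∈ {1,2,3,…}, the Lyapunov drift satisfies Δ(t) ≤ B + Σ_{i=1}^k Q_i(t)·[g_{t−1,i}(X_{t−1}) + g_{t−1,i}'(X_{t−1})ᵀ(X_t − X_{t−1})], where B = k(F + GD)²/2. -/

import Mathlib

open scoped RealInnerProductSpace

/-- **Drift bound (Lemma 3).**  For every slot `t ∈ {1,2,3,…}` (encoded as `t = τ+1`),
the Lyapunov drift `Δ(t) = L(t+1) − L(t)` with `L(t) = ½‖Q(t)‖²` satisfies
`Δ(t) ≤ B + Σ_{i=1}^k Q_i(t)·[g_{t−1,i}(X_{t−1}) + g_{t−1,i}'(X_{t−1})ᵀ(X_t − X_{t−1})]`,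
where `B = k(F + GD)²/2`. -/
theorem stmt2 (n k : ℕ) (hk : 0 < k)
    (𝒳 : Set (EuclideanSpace ℝ (Fin n)))
    (h_ne : 𝒳.Nonempty) (h_cpt : IsCompact 𝒳) (h_cvx : Convex ℝ 𝒳)
    (D F G : ℝ) (hD : 0 ≤ D) (hF : 0 ≤ F) (hG : 0 ≤ G)
    (hdiam : ∀ x ∈ 𝒳, ∀ y ∈ 𝒳, ‖x - y‖ ≤ D)
    (f : ℕ → EuclideanSpace ℝ (Fin n) → ℝ)
    (g : ℕ → Fin k → EuclideanSpace ℝ (Fin n) → ℝ)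
    (hfconv : ∀ t, ConvexOn ℝ 𝒳 (f t))
    (hgconv : ∀ t i, ConvexOn ℝ 𝒳 (g t i))
    (hfbd : ∀ t, ∀ x ∈ 𝒳, |f t x| ≤ F)
    (hgbd : ∀ t i, ∀ x ∈ 𝒳, |g t i x| ≤ F)
    (f' : ℕ → EuclideanSpace ℝ (Fin n) → EuclideanSpace ℝ (Fin n))
    (g' : ℕ → Fin k → EuclideanSpace ℝ (Fin n) → EuclideanSpace ℝ (Fin n))
    (hfsub : ∀ t, ∀ x ∈ 𝒳, ∀ y ∈ 𝒳, f t x + ⟪f' t x, y - x⟫ ≤ f t y)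
    (hgsub : ∀ t i, ∀ x ∈ 𝒳, ∀ y ∈ 𝒳, g t i x + ⟪g' t i x, y - x⟫ ≤ g t i y)
    (hf'bd : ∀ t, ∀ x ∈ 𝒳, ‖f' t x‖ ≤ G)
    (hg'bd : ∀ t i, ∀ x ∈ 𝒳, ‖g' t i x‖ ≤ G)
    (X : ℕ → EuclideanSpace ℝ (Fin n)) (hX : ∀ t, X t ∈ 𝒳)
    (Q : ℕ → Fin k → ℝ)
    (hQ0 : ∀ i, Q 0 i = 0) (hQ1 : ∀ i, Q 1 i = 0)
    (hQrec : ∀ t i, Q (t + 2) i =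
      max (Q (t + 1) i + g t i (X t) + ⟪g' t i (X t), X (t + 1) - X t⟫) 0)
    (L : ℕ → ℝ) (hL : ∀ t, L t = (1 / 2) * ∑ i, (Q t i) ^ 2)
    (B : ℝ) (hB : B = (k : ℝ) * (F + G * D) ^ 2 / 2) :
    ∀ t : ℕ, L (t + 2) - L (t + 1) ≤
      B + ∑ i, Q (t + 1) i * (g t i (X t) + ⟪g' t i (X t), X (t + 1) - X t⟫) := by
  intro t
  have key : ∀ i, (1 / 2) * (Q (t + 2) i) ^ 2 - (1 / 2) * (Q (t + 1) i) ^ 2 ≤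
      (F + G * D) ^ 2 / 2
        + Q (t + 1) i * (g t i (X t) + ⟪g' t i (X t), X (t + 1) - X t⟫) := by
    intro i
    rw [hQrec]
    have h1 := hgbd t i (X t) (hX t)
    have h2 : |⟪g' t i (X t), X (t + 1) - X t⟫| ≤ G * D :=
      (abs_real_inner_le_norm _ _).trans
        (mul_le_mul (hg'bd t i _ (hX t)) (hdiam _ (hX _) _ (hX _)) (norm_nonneg _) hG)
    generalize ⟪g' t i (X t), X (t + 1) - X t⟫ = b at *
    generalize g t i (X t) = a at *
    generalize Q (t + 1) i = q at *
    have h3 : |a + b| ≤ F + G * D := (abs_add_le a b).trans (add_le_add h1 h2)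
    have h4 : (a + b) ^ 2 ≤ (F + G * D) ^ 2 :=
      sq_le_sq.mpr (h3.trans (le_abs_self _))
    have h5 : (max (q + a + b) 0) ^ 2 ≤ (q + a + b) ^ 2 := by
      rcases max_cases (q + a + b) 0 with ⟨h, _⟩ | ⟨h, _⟩
      · rw [h]
      · rw [h]; nlinarith [sq_nonneg (q + a + b)]
    nlinarith
  have hs := Finset.sum_le_sum (s := Finset.univ) (fun i _ => key i)
  rw [Finset.sum_sub_distrib, Finset.sum_add_distrib, ← Finset.mul_sum, ← Finset.mul_sum,
    Finset.sum_const, Finset.card_univ, Fintype.card_fin, nsmul_eq_mul] at hs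
  rw [hL, hL, hB]
  linarith
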